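/- For every natural number k, the composition of the polynomial Q_k with 2X − 2 equals the Chebyshev polynomial U_k of the second kind over ℚ. -/

import Mathlib

open Polynomial

/-- The polynomial `Q_k(T) = ∑_{j=0}^{k} binom(k+j+1, 2j+1) * T^j` with rational
coefficients. -/
noncomputable def Q (k : ℕ) : ℚ[X] :=
  ∑ j ∈ Finset.range (k + 1), C ((Nat.choose (k + j + 1) (2 * j + 1) : ℚ)) * X ^ j

lemma Q_coeff (k j : ℕ) : (Q k).coeff j = (Nat.choose (k + j + 1) (2 * j + 1) : ℚ) := by
  simp only [Q, finsetSum_coeff, coeff_C_mul, coeff_X_pow, mul_ite, mul_one, mul_zero,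
    Finset.sum_ite_eq, Finset.mem_range]
  split_ifs with h
  · rfl
  · rw [Nat.choose_eq_zero_of_lt (by omega)]; simp

lemma Q_rec (k : ℕ) : Q (k + 2) = X * Q (k + 1) + C 2 * Q (k + 1) - Q k := by
  ext j
  cases j with
  | zero =>
    simp only [coeff_sub, coeff_add, coeff_C_mul, coeff_X_mul_zero, Q_coeff]
    simp
    ring
  | succ j =>
    simp only [coeff_sub, coeff_add, coeff_C_mul, coeff_X_mul, Q_coeff]
    rw [show k + 2 + (j + 1) + 1 = (k + j + 2) + 1 + 1 by ring,
      show k + 1 + (j + 1) + 1 = (k + j + 2) + 1 by ring,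
      show k + 1 + j + 1 = k + j + 2 by ring,
      show k + (j + 1) + 1 = k + j + 2 by ring,
      show 2 * (j + 1) + 1 = (2 * j + 1) + 1 + 1 by ring]
    simp only [Nat.choose_succ_succ' (k + j + 2 + 1), Nat.choose_succ_succ' (k + j + 2)]
    push_cast
    ring

/-- For every natural number `k`, the composition of `Q_k` with `2X - 2` equals the
Chebyshev polynomial `U_k` of the second kind over `ℚ`. -/
theorem stmt_6 (k : ℕ) : (Q k).comp (2 * X - 2) = Polynomial.Chebyshev.U ℚ k := by
  induction k using Nat.twoStepInduction with
  | zero => simp [Q]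
  | one =>
    simp [Q, Finset.sum_range_succ]
  | more k h0 h1 =>
    rw [Q_rec]
    push_cast at h1 ⊢
    rw [Chebyshev.U_add_two, ← h0, ← h1]
    simp only [sub_comp, add_comp, mul_comp, X_comp, C_comp]
    rw [show (C 2 : ℚ[X]) = 2 from rfl]
    ring
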